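/- arXiv:1003.5461 — 4 statements merged into one kernel-verified Lean document; each statement's English description precedes it below -/
import Mathlib

section
/- Let d ≥ 1, let p_1 < … < p_d be the first d prime numbers, let N ≥ 2 be an integer, let C > 0 and p ≥ 1 be reals, let b_1,…,b_d be the columns of Schnorr's p-norm Prime Number Lattice basis S_p, let t = C ln N·e_{d+1}, and set D_d = 1 + C² ∑_{i=1}^d (ln p_i)^{2−2/p}. Let t^⋆ be the (d+1)-st vector of the Gram–Schmidt orthogonalization of b_1,…,b_d,t. Then the orthogonal projection t − t^⋆ of t onto the span of {b_1,…,b_d} satisfies: its i-th coordinate equals C² (ln N)(ln p_i)^{1−1/p}/D_d for 1 ≤ i ≤ d, and its (d+1)-st coordinate equals C (ln N)(D_d − 1)/D_d. -/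
open Finset RealInnerProductSpace

open InnerProductSpace in
/-- The textbook Gram–Schmidt recursion determines Mathlib's `gramSchmidt`. -/
theorem eq_gramSchmidt_of_recursion {ι E : Type*} [LinearOrder ι] [LocallyFiniteOrderBot ι]
    [WellFoundedLT ι] [NormedAddCommGroup E] [InnerProductSpace ℝ E] {w gs : ι → E}
    (hgs : ∀ k, gs k = w k - ∑ j ∈ Finset.Iio k, (⟪w k, gs j⟫ / ⟪gs j, gs j⟫) • gs j) :
    gs = gramSchmidt ℝ w := by
  funext k
  induction k using WellFoundedLT.induction with
  | ind k ih =>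
    rw [hgs k, gramSchmidt_def]
    refine congrArg (w k - ·) (Finset.sum_congr rfl fun j hj => ?_)
    rw [ih j (Finset.mem_Iio.mp hj), Submodule.starProjection_singleton,
      real_inner_comm, real_inner_self_eq_norm_sq]
    rfl

open InnerProductSpace in
/-- A vector orthogonal to all `w j` with `j < k` is orthogonal to `w k - gramSchmidt ℝ w k`. -/
theorem inner_sub_gramSchmidt_eq_zero {ι E : Type*} [LinearOrder ι] [LocallyFiniteOrderBot ι]
    [WellFoundedLT ι] [NormedAddCommGroup E] [InnerProductSpace ℝ E] {w : ι → E} {k : ι} {n : E}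
    (hn : ∀ j < k, ⟪n, w j⟫ = 0) : ⟪n, w k - gramSchmidt ℝ w k⟫ = 0 := by
  have hle : Submodule.span ℝ (w '' Set.Iio k) ≤ (Submodule.span ℝ {n})ᗮ := by
    rw [Submodule.span_le]
    rintro _ ⟨j, hj, rfl⟩
    exact Submodule.mem_orthogonal_singleton_iff_inner_right.mpr (hn j hj)
  refine Submodule.mem_orthogonal_singleton_iff_inner_right.mp (hle ?_)
  rw [← span_gramSchmidt_Iio, gramSchmidt_def, sub_sub_cancel]
  refine Submodule.sum_mem _ fun j hj => ?_
  have hspan : Submodule.span ℝ {gramSchmidt ℝ w j} ≤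
      Submodule.span ℝ (gramSchmidt ℝ w '' Set.Iio k) :=
    Submodule.span_mono (Set.singleton_subset_iff.mpr
      (Set.mem_image_of_mem _ (Finset.mem_Iio.mp hj)))
  exact hspan (Submodule.starProjection_apply_mem _ _)

/-- Coordinates of the orthogonal projection `t − t⋆` of the target vector `t` onto the
span of the columns `b₁, …, b_d` of Schnorr's `p`-norm Prime Number Lattice basis. -/
theorem schnorr_target_projection_coords
    (d : ℕ) (hd : 1 ≤ d) (N : ℕ) (hN : 2 ≤ N) (C p : ℝ) (hC : 0 < C) (hp : 1 ≤ p)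
    (w : Fin (d + 1) → EuclideanSpace ℝ (Fin (d + 1)))
    (hw : ∀ (j i : Fin (d + 1)), w j i =
      if (j : ℕ) < d then
        (if (i : ℕ) = (j : ℕ) then Real.log (Nat.nth Nat.Prime (j : ℕ)) ^ (1 / p)
         else if (i : ℕ) = d then C * Real.log (Nat.nth Nat.Prime (j : ℕ)) else 0)
      else (if (i : ℕ) = d then C * Real.log N else 0))
    (t : EuclideanSpace ℝ (Fin (d + 1)))
    (ht : ∀ i : Fin (d + 1), t i = if (i : ℕ) = d then C * Real.log N else 0)
    (gs : Fin (d + 1) → EuclideanSpace ℝ (Fin (d + 1)))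
    (hgs : ∀ k, gs k = w k - ∑ j ∈ Finset.Iio k, (⟪w k, gs j⟫ / ⟪gs j, gs j⟫) • gs j)
    (D : ℕ → ℝ)
    (hD : ∀ j, D j = 1 + C ^ 2 * ∑ i ∈ Finset.range j,
      Real.log (Nat.nth Nat.Prime i) ^ (2 - 2 / p)) :
    ∀ i : Fin (d + 1),
      ((i : ℕ) < d → (t - gs (Fin.last d)) i =
        C ^ 2 * Real.log N * Real.log (Nat.nth Nat.Prime (i : ℕ)) ^ (1 - 1 / p) / D d) ∧
      ((i : ℕ) = d → (t - gs (Fin.last d)) i = C * Real.log N * (D d - 1) / D d) := by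
  obtain rfl := eq_gramSchmidt_of_recursion hgs
  have horth : ∀ j : Fin d, ⟪InnerProductSpace.gramSchmidt ℝ w (Fin.last d), w j.castSucc⟫ = 0 :=
    fun j => InnerProductSpace.gramSchmidt_inv_triangular ℝ w (Fin.castSucc_lt_last j)
  have hproj := fun n => inner_sub_gramSchmidt_eq_zero (w := w) (k := Fin.last d) (n := n)
  have hwt : w (Fin.last d) = t := by
    ext i
    simp [hw, ht]
  rw [hwt] at hproj
  clear hgs
  generalize InnerProductSpace.gramSchmidt ℝ w (Fin.last d) = u at *
  have hxpos : ∀ n, 0 < Real.log (Nat.nth Nat.Prime n) := fun n =>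
    Real.log_pos (by exact_mod_cast (Nat.prime_nth_prime n).one_lt)
  generalize hx : (fun n : ℕ => Real.log (Nat.nth Nat.Prime n)) = x
  have hx' : ∀ n, Real.log (Nat.nth Nat.Prime n) = x n := fun n => congrFun hx n
  simp only [hx'] at *
  have hne : ∀ i : Fin d, (i : ℕ) ≠ d := fun i => i.isLt.ne
  have hne' : ∀ i : Fin d, d ≠ (i : ℕ) := fun i => i.isLt.ne'
  have hpow : ∀ j, x j ^ (1 - 1 / p) * x j ^ (1 / p) = x j := fun j => by
    rw [← Real.rpow_add (hxpos j)]
    simp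
  have hinner : ∀ (v : EuclideanSpace ℝ (Fin (d + 1))) (j : Fin d),
      ⟪v, w j.castSucc⟫ = x j ^ (1 / p) * v j.castSucc + C * x j * v (Fin.last d) := by
    intro v j
    simp [PiLp.inner_apply, Fin.sum_univ_castSucc, hw, hne, hne', Fin.val_inj]
  have hu_coord : ∀ j : Fin d, u j.castSucc = -(C * x j ^ (1 - 1 / p)) * u (Fin.last d) := by
    intro j
    have h := horth j
    rw [hinner] at h
    apply mul_right_cancel₀ (Real.rpow_pos_of_pos (hxpos j) (1 / p)).ne'
    linear_combination h + C * u (Fin.last d) * hpow j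
  have hDpos : 0 < D d := by
    rw [hD]
    have : 0 ≤ ∑ i ∈ Finset.range d, x i ^ (2 - 2 / p) :=
      Finset.sum_nonneg fun i _ => (Real.rpow_pos_of_pos (hxpos i) _).le
    positivity
  have hlast : u (Fin.last d) * D d = C * Real.log N := by
    have h := hproj (WithLp.toLp 2 (Fin.snoc (fun j : Fin d => -(C * x j ^ (1 - 1 / p))) 1))
      (fun j hj => by
        obtain ⟨j, rfl⟩ := Fin.exists_castSucc_eq.mpr hj.ne
        rw [hinner]
        simp only [Fin.snoc_castSucc, Fin.snoc_last]
        linear_combination -C * hpow j)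
    have hsq : ∀ j, x j ^ (1 - 1 / p) * x j ^ (1 - 1 / p) = x j ^ (2 - 2 / p) := fun j => by
      rw [← Real.rpow_add (hxpos j)]
      ring_nf
    have hterm : ∀ j : Fin d, (t - u) j.castSucc * -(C * x j ^ (1 - 1 / p)) =
        -(C ^ 2 * u (Fin.last d)) * x j ^ (2 - 2 / p) := fun j => by
      rw [PiLp.sub_apply, ht, hu_coord, ← hsq]
      simp only [Fin.val_castSucc, hne, if_false]
      ring
    simp only [PiLp.inner_apply, Fin.sum_univ_castSucc, Fin.snoc_castSucc, Fin.snoc_last,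
      RCLike.inner_apply, conj_trivial, hterm, ← Finset.mul_sum] at h
    rw [PiLp.sub_apply, ht, Fin.sum_univ_eq_sum_range (fun j => x j ^ (2 - 2 / p))] at h
    simp only [Fin.val_last, if_true] at h
    rw [hD]
    linear_combination -h
  have hlast' : u (Fin.last d) = C * Real.log N / D d := by
    rw [eq_div_iff hDpos.ne', hlast]
  intro i
  refine Fin.lastCases ?_ (fun j => ?_) i
  · refine ⟨fun h => absurd h (lt_irrefl d), fun _ => ?_⟩
    rw [PiLp.sub_apply, ht, hlast']
    simp only [Fin.val_last, if_true]
    field_simp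
  · refine ⟨fun _ => ?_, fun h => absurd h (hne j)⟩
    rw [PiLp.sub_apply, ht, hu_coord, hlast']
    simp only [Fin.val_castSucc, hne, if_false]
    ring
end

section
/- Let d ≥ 1, let p_1 < … < p_d be the first d prime numbers, let N ≥ 2 be an integer, let C > 1 be real, let S_1 be Schnorr's 1-norm Prime Number Lattice basis matrix and let t = C ln N·e_{d+1}. Let z ∈ ℤ^d, and set u = ∏_{1≤i≤d, z_i>0} p_i^{z_i} and k = ∏_{1≤i≤d, z_i<0} p_i^{−z_i}. If ‖S_1 z − t‖_1 ≤ ε for a real ε, then |u − k N| ≤ (√N/C)·exp(ε/2). -/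
open Finset Matrix

lemma mul_two_sinh_le_exp_mul {C y : ℝ} (hC : 1 ≤ C) (hy : 0 ≤ y) :
    C * (Real.exp y - Real.exp (-y)) ≤ Real.exp (C * y) := by
  rcases le_total y 1 with h1 | h1
  · have habs : |y| = y := abs_of_nonneg hy
    have hpos := Real.exp_bound (x := y) (by rwa [habs]) (n := 3) (by norm_num)
    have hneg := Real.exp_bound (x := -y) (by rwa [abs_neg, habs]) (n := 3) (by norm_num)
    norm_num [Finset.sum_range_succ, Nat.factorial, habs] at hpos hneg
    have hsinh : Real.exp y - Real.exp (-y) ≤ 2.5 * y := by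
      have hcube : y ^ 3 ≤ y := pow_le_of_le_one hy h1 (by norm_num)
      linarith [(abs_le.mp hpos).2, (abs_le.mp hneg).1]
    have he : Real.exp 1 * (C * y) ≤ Real.exp (C * y) := by
      calc Real.exp 1 * (C * y) ≤ Real.exp 1 * Real.exp (C * y - 1) := by
            gcongr
            linarith [Real.add_one_le_exp (C * y - 1)]
        _ = Real.exp (C * y) := by rw [← Real.exp_add]; ring_nf
    have hCy : 0 ≤ C * y := by positivity
    calc C * (Real.exp y - Real.exp (-y)) ≤ C * (2.5 * y) := by gcongr
      _ = 2.5 * (C * y) := by ring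
      _ ≤ Real.exp 1 * (C * y) := by
        gcongr
        linarith [Real.exp_one_gt_d9]
      _ ≤ _ := he
  · calc C * (Real.exp y - Real.exp (-y)) ≤ C * Real.exp y := by
          gcongr
          linarith [Real.exp_pos (-y)]
      _ ≤ Real.exp ((C - 1) * y) * Real.exp y := by
          gcongr
          nlinarith [Real.add_one_le_exp ((C - 1) * y)]
      _ = Real.exp (C * y) := by rw [← Real.exp_add]; ring_nf

lemma mul_abs_exp_sub_exp_le {C : ℝ} (hC : 1 ≤ C) (a b : ℝ) :
    C * |Real.exp a - Real.exp b| ≤ Real.exp ((a + b + C * |a - b|) / 2) := by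
  wlog hab : b ≤ a generalizing a b
  · rw [abs_sub_comm, add_comm a b, abs_sub_comm a b]
    exact this b a (le_of_not_ge hab)
  rw [abs_of_nonneg (sub_nonneg.mpr (Real.exp_le_exp.mpr hab)),
    abs_of_nonneg (sub_nonneg.mpr hab)]
  have ha : Real.exp a = Real.exp ((a + b) / 2) * Real.exp ((a - b) / 2) := by
    rw [← Real.exp_add]; ring_nf
  have hb : Real.exp b = Real.exp ((a + b) / 2) * Real.exp (-((a - b) / 2)) := by
    rw [← Real.exp_add]; ring_nf
  calc C * (Real.exp a - Real.exp b)
      = Real.exp ((a + b) / 2) *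
          (C * (Real.exp ((a - b) / 2) - Real.exp (-((a - b) / 2)))) := by
        rw [ha, hb]; ring
    _ ≤ Real.exp ((a + b) / 2) * Real.exp (C * ((a - b) / 2)) := by
        gcongr
        exact mul_two_sinh_le_exp_mul hC (by linarith)
    _ = Real.exp ((a + b + C * (a - b)) / 2) := by rw [← Real.exp_add]; ring_nf

lemma log_prod_pow_toNat {ι : Type*} [Fintype ι] (p : ι → ℕ) (hp : ∀ i, 0 < p i) (z : ι → ℤ) :
    Real.log ((∏ i, if 0 < z i then p i ^ (z i).toNat else 1 : ℕ) : ℝ) =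
      ∑ i, max (z i : ℝ) 0 * Real.log (p i) := by
  push_cast
  rw [Real.log_prod (fun i _ => by have := hp i; split_ifs <;> positivity)]
  refine Finset.sum_congr rfl fun i _ => ?_
  split_ifs with hi
  · have hcast : (((z i).toNat : ℤ) : ℝ) = z i := by rw [Int.toNat_of_nonneg hi.le]
    rw [Real.log_pow, max_eq_left (by exact_mod_cast hi.le), ← hcast, Int.cast_natCast]
  · rw [max_eq_right (by exact_mod_cast not_lt.mp hi)]
    simp

/-- Lemma `cvp-suff`: if `‖S₁ z − t‖₁ ≤ ε`, then `|u − k N| ≤ (√N/C) · exp(ε/2)`. -/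
theorem schnorr_cvp_suff
    (d : ℕ) (hd : 1 ≤ d) (N : ℕ) (hN : 2 ≤ N) (C : ℝ) (hC : 1 < C)
    (S : Matrix (Fin (d + 1)) (Fin d) ℝ)
    (hS : ∀ i j, S i j =
      if (i : ℕ) = (j : ℕ) then Real.log (Nat.nth Nat.Prime (j : ℕ))
      else if (i : ℕ) = d then C * Real.log (Nat.nth Nat.Prime (j : ℕ)) else 0)
    (t : Fin (d + 1) → ℝ) (ht : ∀ i, t i = if (i : ℕ) = d then C * Real.log N else 0)
    (z : Fin d → ℤ)
    (u : ℕ) (hu : u = ∏ i : Fin d,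
      if 0 < z i then Nat.nth Nat.Prime (i : ℕ) ^ (z i).toNat else 1)
    (k : ℕ) (hk : k = ∏ i : Fin d,
      if z i < 0 then Nat.nth Nat.Prime (i : ℕ) ^ (-z i).toNat else 1)
    (ε : ℝ)
    (h : ∑ i, |(S.mulVec (fun j => (z j : ℝ)) - t) i| ≤ ε) :
    |(u : ℝ) - k * N| ≤ Real.sqrt N / C * Real.exp (ε / 2) := by
  have hp : ∀ i : Fin d, 0 < Nat.nth Nat.Prime (i : ℕ) := fun i => (Nat.prime_nth_prime _).pos
  have hNpos : (0 : ℝ) < N := by exact_mod_cast (by omega : 0 < N)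
  have hupos : (0 : ℝ) < u := by
    rw [hu]
    exact_mod_cast Finset.prod_pos fun i _ => by have := hp i; split_ifs <;> positivity
  have hkpos : (0 : ℝ) < k := by
    rw [hk]
    exact_mod_cast Finset.prod_pos fun i _ => by have := hp i; split_ifs <;> positivity
  have hlogu : Real.log u =
      ∑ i, max (z i : ℝ) 0 * Real.log (Nat.nth Nat.Prime (i : ℕ)) := by
    rw [hu]
    exact log_prod_pow_toNat (fun i : Fin d => Nat.nth Nat.Prime (i : ℕ)) hp z
  have hlogk : Real.log k =
      ∑ i, max (-(z i : ℝ)) 0 * Real.log (Nat.nth Nat.Prime (i : ℕ)) := by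
    rw [hk]
    simpa using log_prod_pow_toNat (fun i : Fin d => Nat.nth Nat.Prime (i : ℕ)) hp (-z)
  have hdiag : ∀ i : Fin d, (S.mulVec (fun j => (z j : ℝ)) - t) i.castSucc =
      z i * Real.log (Nat.nth Nat.Prime (i : ℕ)) := by
    intro i
    have hi := i.isLt.ne
    simp [Matrix.mulVec, dotProduct, hS, ht, hi, Fin.val_inj, mul_comm]
  have hlast : (S.mulVec (fun j => (z j : ℝ)) - t) (Fin.last d) =
      C * (Real.log u - Real.log (k * N)) := by
    have hd' : ∀ j : Fin d, d ≠ (j : ℕ) := fun j => j.isLt.ne'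
    rw [Real.log_mul hkpos.ne' hNpos.ne', hlogu, hlogk, ← sub_sub, ← Finset.sum_sub_distrib,
      mul_sub, Finset.mul_sum]
    simp only [Pi.sub_apply, Matrix.mulVec, dotProduct, hS, ht, Fin.val_last, hd', if_true,
      if_false]
    congr 1
    refine Finset.sum_congr rfl fun i _ => ?_
    rw [← sub_mul, max_zero_sub_max_neg_zero_eq_self]
    ring
  have hnorm : Real.log u + Real.log k + C * |Real.log u - Real.log (k * N)| ≤ ε := by
    rw [Fin.sum_univ_castSucc, hlast, abs_mul, abs_of_pos (by linarith : 0 < C)] at h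
    refine le_trans (le_of_eq ?_) h
    rw [hlogu, hlogk, ← Finset.sum_add_distrib]
    congr 1
    refine Finset.sum_congr rfl fun i _ => ?_
    have hlog : 0 ≤ Real.log (Nat.nth Nat.Prime (i : ℕ)) := Real.log_natCast_nonneg _
    rw [hdiag, abs_mul, abs_of_nonneg hlog, ← add_mul,
      max_zero_add_max_neg_zero_eq_abs_self]
  have hmain := mul_abs_exp_sub_exp_le hC.le (Real.log u) (Real.log (k * N))
  rw [Real.exp_log hupos, Real.exp_log (mul_pos hkpos hNpos)] at hmain
  have hsqrt : Real.sqrt N = Real.exp (Real.log N / 2) := by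
    rw [Real.exp_half, Real.exp_log hNpos]
  rw [div_mul_eq_mul_div, le_div_iff₀ (by linarith), mul_comm, hsqrt, ← Real.exp_add]
  refine hmain.trans (Real.exp_le_exp.mpr ?_)
  have hlogkN := Real.log_mul hkpos.ne' hNpos.ne'
  linarith
end

section
/- Let d ≥ 1, let x_1,…,x_d be nonzero real numbers and y_1,…,y_{d+1} real numbers with y_{d+1} ≠ 0, and let v_1,…,v_{d+1} ∈ ℝ^{d+1} be defined by v_i = x_i·e_i + y_i·e_{d+1} for 1 ≤ i ≤ d and v_{d+1} = y_{d+1}·e_{d+1}. Set K_0 = 1 and K_j = 1 + ∑_{i=1}^j (y_i/x_i)² for 1 ≤ j ≤ d, and let v_1^⋆,…,v_{d+1}^⋆ be the Gram–Schmidt orthogonalization of v_1,…,v_{d+1}. Then the Gram–Schmidt coefficients satisfy μ_{k,j} := ⟨v_k, v_j^⋆⟩/⟨v_j^⋆, v_j^⋆⟩ = y_k·y_j/(x_j²·K_j) for all 1 ≤ j < k ≤ d+1. -/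
open Finset RealInnerProductSpace

/-- The `i`-th coordinate of the `m`-th Gram–Schmidt vector, `m < d`. -/
noncomputable def gsoCoord (d : ℕ) (x y K : ℕ → ℝ) (m i : ℕ) : ℝ :=
  if i < m then -(y m * (y i / x i) / K m)
  else if i = m then x m
  else if i = d then y m / K m else 0

theorem sum_coeff_mul_gsoCoord {d : ℕ} {x y K : ℕ → ℝ} (hx : ∀ i < d, x i ≠ 0)
    (hK_zero : K 0 = 1) (hK_succ : ∀ j, K (j + 1) = K j + (y j / x j) ^ 2)
    (hK_pos : ∀ j, 0 < K j) (i : ℕ) {k : ℕ} (hk : k ≤ d) :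
    ∑ j ∈ range k, y j / (x j ^ 2 * K (j + 1)) * gsoCoord d x y K j i =
      if i < k then y i / x i / K k else if i = d then 1 - 1 / K k else 0 := by
  induction k with
  | zero => simp [hK_zero]
  | succ k ih =>
    rw [sum_range_succ, ih (by omega)]
    have hxk := hx k (by omega)
    have hKk := (hK_pos k).ne'
    have hKk' := (hK_pos (k + 1)).ne'
    have hrec : K (k + 1) * x k ^ 2 = K k * x k ^ 2 + y k ^ 2 := by
      rw [hK_succ]; field_simp
    have htel : y k / (x k ^ 2 * K (k + 1)) * (y k / K k) = 1 / K k - 1 / K (k + 1) := by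
      field_simp
      linear_combination -hrec
    unfold gsoCoord
    rcases lt_trichotomy i k with h | rfl | h
    · rw [if_pos h, if_pos h, if_pos (by omega)]
      linear_combination (-(y i / x i)) * htel
    · rw [if_neg (lt_irrefl _), if_neg (by omega), if_neg (lt_irrefl _), if_pos rfl,
        if_pos (by omega)]
      field_simp
      ring
    · rw [if_neg (show ¬ i < k by omega), if_neg (show ¬ i < k by omega),
        if_neg (show ¬ i = k by omega), if_neg (show ¬ i < k + 1 by omega)]
      split_ifs
      · linear_combination htel
      · simp

theorem sum_gsoCoord_sq {d : ℕ} {x y K : ℕ → ℝ} (hx : ∀ i < d, x i ≠ 0)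
    (hK : ∀ j, K j = 1 + ∑ i ∈ range j, (y i / x i) ^ 2)
    (hK_pos : ∀ j, 0 < K j) {j : ℕ} (hj : j < d) :
    ∑ i ∈ range (d + 1), gsoCoord d x y K j i ^ 2 = x j ^ 2 * K (j + 1) / K j := by
  have hxj := hx j hj
  have hKj := (hK_pos j).ne'
  have hsub : ∑ i ∈ range (j + 1), gsoCoord d x y K j i ^ 2 =
      ∑ i ∈ range d, gsoCoord d x y K j i ^ 2 := by
    refine sum_subset (range_subset_range.2 hj) fun i hi hi' => ?_
    rw [mem_range] at hi hi'
    rw [gsoCoord, if_neg (by omega), if_neg (by omega), if_neg (by omega), zero_pow two_ne_zero]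
  have hlow : ∑ i ∈ range j, gsoCoord d x y K j i ^ 2 = (y j / K j) ^ 2 * (K j - 1) := by
    rw [hK j, add_sub_cancel_left, ← hK j, mul_sum]
    refine sum_congr rfl fun i hi => ?_
    rw [gsoCoord, if_pos (mem_range.1 hi)]
    ring
  have hdiag : gsoCoord d x y K j j = x j := by simp [gsoCoord]
  have hlast : gsoCoord d x y K j d = y j / K j := by
    rw [gsoCoord, if_neg (by omega), if_neg (by omega), if_pos rfl]
  have hrec : K (j + 1) = K j + (y j / x j) ^ 2 := by
    rw [hK (j + 1), hK j, sum_range_succ, add_assoc]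
  rw [sum_range_succ, ← hsub, sum_range_succ, hlow, hdiag, hlast, hrec]
  field_simp
  ring

/-- Lemma `gsouse`, part (gsc): the Gram–Schmidt coefficients satisfy
`μ_{k,j} = ⟨v_k, v_j⋆⟩/⟨v_j⋆, v_j⋆⟩ = y_k y_j / (x_j² K_j)` for `j < k`. -/
theorem gso_identity_with_extra_row_coeffs
    (d : ℕ) (hd : 1 ≤ d) (x y : ℕ → ℝ)
    (hx : ∀ i < d, x i ≠ 0) (hy : y d ≠ 0)
    (v : Fin (d + 1) → EuclideanSpace ℝ (Fin (d + 1)))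
    (hv : ∀ (j i : Fin (d + 1)), v j i =
      if (i : ℕ) = (j : ℕ) ∧ (j : ℕ) < d then x (j : ℕ)
      else if (i : ℕ) = d then y (j : ℕ) else 0)
    (gs : Fin (d + 1) → EuclideanSpace ℝ (Fin (d + 1)))
    (hgs : ∀ k, gs k = v k - ∑ j ∈ Finset.Iio k, (⟪v k, gs j⟫ / ⟪gs j, gs j⟫) • gs j)
    (K : ℕ → ℝ)
    (hK : ∀ j, K j = 1 + ∑ i ∈ Finset.range j, (y i / x i) ^ 2) :
    ∀ j k : Fin (d + 1), (j : ℕ) < (k : ℕ) →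
      ⟪v k, gs j⟫ / ⟪gs j, gs j⟫ = y (k : ℕ) * y (j : ℕ) / (x (j : ℕ) ^ 2 * K ((j : ℕ) + 1)) := by
  have hK_zero : K 0 = 1 := by simp [hK]
  have hK_succ : ∀ j, K (j + 1) = K j + (y j / x j) ^ 2 := fun j => by
    rw [hK (j + 1), hK j, sum_range_succ, add_assoc]
  have hK_pos : ∀ j, 0 < K j := fun j => by rw [hK]; positivity
  have coeff : ∀ j k : Fin (d + 1), (j : ℕ) < (k : ℕ) →
      (∀ i, gs j i = gsoCoord d x y K j i) →
      ⟪v k, gs j⟫ / ⟪gs j, gs j⟫ =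
        y (k : ℕ) * y (j : ℕ) / (x (j : ℕ) ^ 2 * K ((j : ℕ) + 1)) := by
    intro j k hjk hg
    have hjd : (j : ℕ) < d := by omega
    have hxj := hx j hjd
    have hKj := (hK_pos j).ne'
    have hKj' := (hK_pos (j + 1)).ne'
    have hself : ⟪gs j, gs j⟫ = x j ^ 2 * K (j + 1) / K j := by
      rw [← sum_gsoCoord_sq hx hK hK_pos hjd, ← Fin.sum_univ_eq_sum_range
        (fun i => gsoCoord d x y K j i ^ 2), PiLp.inner_apply]
      refine sum_congr rfl fun i _ => ?_
      rw [hg, real_inner_self_eq_norm_sq, Real.norm_eq_abs, sq_abs]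
    have hcross : ⟪v k, gs j⟫ = y k * (y j / K j) := by
      rw [PiLp.inner_apply, sum_eq_single (Fin.last d)]
      · rw [hg, hv, gsoCoord, Fin.val_last, if_neg (by omega), if_pos rfl, if_neg (by omega),
          if_neg (by omega), if_pos rfl]
        simp [mul_comm]
      · intro i _ hi
        have hid : (i : ℕ) ≠ d := fun h => hi (Fin.ext h)
        rw [hg, hv, gsoCoord]
        by_cases hik : (i : ℕ) = k
        · rw [if_neg (show ¬ (i : ℕ) < j by omega), if_neg (show ¬ (i : ℕ) = j by omega),
            if_neg hid, if_neg hid, inner_zero_right]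
        · rw [if_neg (fun h => hik h.1), if_neg hid, inner_zero_left]
      · simp
    rw [hself, hcross]
    field_simp
  have coords : ∀ n < d, ∀ k : Fin (d + 1), (k : ℕ) = n →
      ∀ i, gs k i = gsoCoord d x y K k i := by
    intro n
    induction n using Nat.strong_induction_on with
    | _ n ih =>
      intro hn k hk i
      have hsum : ∑ j ∈ Iio k, (⟪v k, gs j⟫ / ⟪gs j, gs j⟫) * gs j i =
          y k * ∑ j ∈ range k, y j / (x j ^ 2 * K (j + 1)) * gsoCoord d x y K j i := by
        have hrange : range (k : ℕ) = (Iio k).map Fin.valEmbedding := by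
          rw [Fin.map_valEmbedding_Iio, Nat.Iio_eq_range]
        rw [hrange, sum_map, mul_sum]
        refine sum_congr rfl fun j hj => ?_
        have hjk : j < k := mem_Iio.1 hj
        have hg := ih j (by omega) (by omega) j rfl
        rw [coeff j k hjk hg, hg, Fin.valEmbedding_apply]
        ring
      have hgi : gs k i = v k i - ∑ j ∈ Iio k, (⟪v k, gs j⟫ / ⟪gs j, gs j⟫) * gs j i := by
        conv_lhs => rw [hgs k]
        simp
      rw [hgi, hsum, sum_coeff_mul_gsoCoord hx hK_zero hK_succ hK_pos i (by omega), hv, gsoCoord]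
      have hKk := (hK_pos k).ne'
      split_ifs <;> first | omega | ring
  exact fun j k hjk => coeff j k hjk (coords j (by omega) j rfl)
end

section
/- Let u, k ≥ 1 be real numbers, let N ≥ 2 be an integer, let γ ≥ 1 be an integer, and let C > 1, ε be real numbers. If ln u + ln k + C·|ln u − ln(k·N^γ)| ≤ ε, then |u − k·N^γ| ≤ (N^{γ/2}/C)·exp(ε/2). -/
theorem Real.mul_sinh_le_sinh_mul {c x : ℝ} (hc : 1 ≤ c) (hx : 0 ≤ x) :
    c * Real.sinh x ≤ Real.sinh (c * x) := by
  have hd (y : ℝ) : HasDerivAt (fun t => Real.sinh (c * t) - c * Real.sinh t)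
      (Real.cosh (c * y) * (c * 1) - c * Real.cosh y) y :=
    ((hasDerivAt_id y).const_mul c).sinh.sub ((Real.hasDerivAt_sinh y).const_mul c)
  have hmono : MonotoneOn (fun t => Real.sinh (c * t) - c * Real.sinh t) (Set.Ici 0) := by
    refine monotoneOn_of_deriv_nonneg (convex_Ici 0)
      (fun y _ => (hd y).continuousAt.continuousWithinAt)
      (fun y _ => (hd y).differentiableAt.differentiableWithinAt) fun y hy => ?_
    rw [interior_Ici, Set.mem_Ioi] at hy
    have hcosh : Real.cosh y ≤ Real.cosh (c * y) := by
      rw [Real.cosh_le_cosh, abs_of_pos hy, abs_of_nonneg (by positivity)]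
      nlinarith
    rw [(hd y).deriv]
    nlinarith
  have := hmono Set.self_mem_Ici hx hx
  simp only [mul_zero, Real.sinh_zero, sub_zero] at this
  linarith

theorem Real.two_mul_mul_sinh_le_exp_mul {c x : ℝ} (hc : 1 ≤ c) (hx : 0 ≤ x) :
    2 * c * Real.sinh x ≤ Real.exp (c * x) := by
  have := Real.mul_sinh_le_sinh_mul hc hx
  rw [Real.sinh_eq (c * x)] at this
  linarith [Real.exp_pos (-(c * x))]

theorem Real.abs_exp_sub_exp (a b : ℝ) :
    |Real.exp a - Real.exp b| = 2 * Real.exp ((a + b) / 2) * Real.sinh (|a - b| / 2) := by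
  have key (a b : ℝ) :
      2 * Real.exp ((a + b) / 2) * Real.sinh ((a - b) / 2) = Real.exp a - Real.exp b := by
    have h₁ : Real.exp a = Real.exp ((a + b) / 2) * Real.exp ((a - b) / 2) := by
      rw [← Real.exp_add]; ring_nf
    have h₂ : Real.exp b = Real.exp ((a + b) / 2) * Real.exp (-((a - b) / 2)) := by
      rw [← Real.exp_add]; ring_nf
    rw [h₁, h₂, Real.sinh_eq]
    ring
  rcases le_total b a with hab | hab
  · rw [abs_of_nonneg (sub_nonneg.2 hab), abs_of_nonneg (sub_nonneg.2 (Real.exp_le_exp.2 hab)), key]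
  · rw [abs_sub_comm a, abs_sub_comm (Real.exp a), add_comm, abs_of_nonneg (sub_nonneg.2 hab),
      abs_of_nonneg (sub_nonneg.2 (Real.exp_le_exp.2 hab)), key]


/-- If `ln u + ln k + C·|ln u − ln(k N^γ)| ≤ ε` with `u, k ≥ 1`, `N ≥ 2`, `γ ≥ 1` and
`C > 1`, then `|u − k N^γ| ≤ (N^{γ/2}/C)·exp(ε/2)`. -/
theorem bounded_one_norm_bounds_difference
    (u k : ℝ) (hu : 1 ≤ u) (hk : 1 ≤ k) (N : ℕ) (hN : 2 ≤ N)
    (γ : ℕ) (hγ : 1 ≤ γ) (C ε : ℝ) (hC : 1 < C)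
    (h : Real.log u + Real.log k + C * |Real.log u - Real.log (k * (N : ℝ) ^ γ)| ≤ ε) :
    |u - k * (N : ℝ) ^ γ| ≤ (N : ℝ) ^ ((γ : ℝ) / 2) / C * Real.exp (ε / 2) := by
  have hN₀ : (0 : ℝ) < N := by positivity
  have hu₀ : 0 < u := by positivity
  have hk₀ : 0 < k := by positivity
  have hy₀ : 0 < k * (N : ℝ) ^ γ := by positivity
  have hlog : Real.log (k * (N : ℝ) ^ γ) = Real.log k + γ * Real.log N := by
    rw [Real.log_mul hk₀.ne' (by positivity), Real.log_pow]
  have habs := Real.abs_exp_sub_exp (Real.log u) (Real.log (k * (N : ℝ) ^ γ))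
  rw [Real.exp_log hu₀, Real.exp_log hy₀] at habs
  have hsinh := Real.two_mul_mul_sinh_le_exp_mul hC.le
    (x := |Real.log u - Real.log (k * (N : ℝ) ^ γ)| / 2) (by positivity)
  rw [habs, div_mul_eq_mul_div, le_div_iff₀ (by positivity), Real.rpow_def_of_pos hN₀,
    ← Real.exp_add]
  set d := |Real.log u - Real.log (k * (N : ℝ) ^ γ)|
  set s := (Real.log u + Real.log (k * (N : ℝ) ^ γ)) / 2 with hs
  calc 2 * Real.exp s * Real.sinh (d / 2) * C
      = Real.exp s * (2 * C * Real.sinh (d / 2)) := by ring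
    _ ≤ Real.exp s * Real.exp (C * (d / 2)) := by gcongr
    _ = Real.exp (s + C * (d / 2)) := (Real.exp_add _ _).symm
    _ ≤ Real.exp (Real.log N * (γ / 2) + ε / 2) := by
      rw [Real.exp_le_exp, hs, hlog]
      linarith
end
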